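/- Let T > 0 and let {u_ε}_{ε>0} be the family of smooth solutions to the viscous approximations of the short pulse equation, satisfying the uniform bounds ‖u_ε‖_{L^∞((0,T)×(0,∞))} ≤ ‖u_0‖_{L^∞(0,∞)} + C(T), ε∫_0^T ‖∂_x u_ε(s,·)‖²_{L²(0,∞)} ds ≤ C(T), and ‖P_ε‖_{L^∞((0,T)×(0,∞))} ≤ C(T) with C(T) independent of ε. Then for every convex entropy η ∈ C²(ℝ) with flux q defined by q′(u) = 3u²η′(u), the family of distributions { ∂_t η(u_ε) + ∂_x q(u_ε) }_{ε>0} lies in a compact subset of H^{-1}_loc((0,T)×(0,∞)). -/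

import Mathlib

open MeasureTheory Set Filter

/-- The derivative of `f` in the direction `v`, as a function of the base point. -/
noncomputable def dirDeriv (v : ℝ × ℝ) (f : ℝ × ℝ → ℝ) (z : ℝ × ℝ) : ℝ := fderiv ℝ f z v

/-- The partial derivative in the time variable. -/
local notation "Dt" => dirDeriv ((1 : ℝ), (0 : ℝ))

/-- The partial derivative in the space variable. -/
local notation "Dx" => dirDeriv ((0 : ℝ), (1 : ℝ))

section DirDeriv

variable {f g : ℝ × ℝ → ℝ} {K : Set (ℝ × ℝ)} {v : ℝ × ℝ}

theorem contDiff_dirDeriv {n m : WithTop ℕ∞} (hf : ContDiff ℝ n f) (hmn : m + 1 ≤ n)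
    (v : ℝ × ℝ) : ContDiff ℝ m (dirDeriv v f) :=
  (hf.fderiv_right hmn).clm_apply contDiff_const

theorem continuous_dirDeriv (hf : ContDiff ℝ 1 f) (v : ℝ × ℝ) : Continuous (dirDeriv v f) :=
  (contDiff_dirDeriv (m := 0) hf (by norm_num) v).continuous

theorem dirDeriv_comp {h : ℝ → ℝ} {h' : ℝ} {z : ℝ × ℝ} (hh : HasDerivAt h h' (f z))
    (hf : DifferentiableAt ℝ f z) (v : ℝ × ℝ) :
    dirDeriv v (fun z => h (f z)) z = h' * dirDeriv v f z := by
  have := (hh.comp_hasFDerivAt z hf.hasFDerivAt).fderiv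
  simp only [dirDeriv]
  rw [show (fun z => h (f z)) = h ∘ f from rfl, this]
  simp

theorem dirDeriv_mul {z : ℝ × ℝ} (hf : DifferentiableAt ℝ f z) (hg : DifferentiableAt ℝ g z)
    (v : ℝ × ℝ) :
    dirDeriv v (fun z => f z * g z) z = f z * dirDeriv v g z + g z * dirDeriv v f z := by
  simp only [dirDeriv]
  rw [fderiv_fun_mul hf hg]
  simp

theorem dirDeriv_sub {z : ℝ × ℝ} (hf : DifferentiableAt ℝ f z) (hg : DifferentiableAt ℝ g z)
    (v : ℝ × ℝ) :
    dirDeriv v (fun z => f z - g z) z = dirDeriv v f z - dirDeriv v g z := by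
  simp only [dirDeriv]
  rw [fderiv_fun_sub hf hg]
  simp

theorem dirDeriv_eq_zero (hK : IsClosed K) (hf : ∀ z ∉ K, f z = 0) (v : ℝ × ℝ) :
    ∀ z ∉ K, dirDeriv v f z = 0 := by
  intro z hz
  have : f =ᶠ[nhds z] fun _ => 0 := by
    filter_upwards [hK.isOpen_compl.mem_nhds hz] with w hw using hf w hw
  simp [dirDeriv, this.fderiv_eq]

theorem integrable_of_eq_zero_off_compact (hf : Continuous f) (hK : IsCompact K)
    (h : ∀ z ∉ K, f z = 0) : Integrable f :=
  hf.integrable_of_hasCompactSupport (HasCompactSupport.intro hK h)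

theorem integral_mul_dirDeriv (hf : ContDiff ℝ 1 f) (hg : ContDiff ℝ 1 g) (hK : IsCompact K)
    (h : ∀ z ∉ K, g z = 0) (v : ℝ × ℝ) :
    ∫ z, f z * dirDeriv v g z = - ∫ z, dirDeriv v f z * g z := by
  have hf' := continuous_dirDeriv hf v
  have hg' := continuous_dirDeriv hg v
  have hfc := hf.continuous
  have hgc := hg.continuous
  refine integral_mul_fderiv_eq_neg_fderiv_mul_of_integrable (μ := volume) (v := v)
    (integrable_of_eq_zero_off_compact (K := K) (hf'.mul hgc) hK ?_)
    (integrable_of_eq_zero_off_compact (K := K) (hfc.mul hg') hK ?_)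
    (integrable_of_eq_zero_off_compact (K := K) (hfc.mul hgc) hK ?_)
    (fun z _ => hf.differentiable (by norm_num) z) (fun z _ => hg.differentiable (by norm_num) z)
  · intro z hz; simp [h z hz]
  · intro z hz
    have := dirDeriv_eq_zero hK.isClosed h v z hz
    simp only [dirDeriv] at this
    simp [this]
  · intro z hz; simp [h z hz]

theorem deriv_fst_eq_Dt {φ : ℝ → ℝ → ℝ} {t x : ℝ}
    (h : DifferentiableAt ℝ (Function.uncurry φ) (t, x)) :
    deriv (fun s => φ s x) t = Dt (Function.uncurry φ) (t, x) := by
  have h2 : HasFDerivAt (fun s : ℝ => (s, x)) (ContinuousLinearMap.inl ℝ ℝ ℝ) t :=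
    hasFDerivAt_prodMk_left t x
  have := (h.hasFDerivAt.comp t h2).hasDerivAt.deriv
  simpa [dirDeriv, Function.comp_def] using this

theorem deriv_snd_eq_Dx {φ : ℝ → ℝ → ℝ} {t x : ℝ}
    (h : DifferentiableAt ℝ (Function.uncurry φ) (t, x)) :
    deriv (fun y => φ t y) x = Dx (Function.uncurry φ) (t, x) := by
  have h2 : HasFDerivAt (fun y : ℝ => (t, y)) (ContinuousLinearMap.inr ℝ ℝ ℝ) x :=
    hasFDerivAt_prodMk_right t x
  have := (h.hasFDerivAt.comp x h2).hasDerivAt.deriv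
  simpa [dirDeriv, Function.comp_def] using this

theorem setIntegral_Ioo_Ioi_eq {T : ℝ} (hf : Continuous f) (hK : IsCompact K)
    (hKT : K ⊆ Ioo (0 : ℝ) T ×ˢ Ioi (0 : ℝ)) (h : ∀ z ∉ K, f z = 0) :
    ∫ t in Ioo (0 : ℝ) T, ∫ x in Ioi (0 : ℝ), f (t, x) = ∫ z, f z := by
  have hi := integrable_of_eq_zero_off_compact hf hK h
  rw [← setIntegral_eq_integral_of_forall_compl_eq_zero (s := Ioo (0 : ℝ) T ×ˢ Ioi (0 : ℝ))
    (fun z hz => h z fun hz' => hz (hKT hz')), Measure.volume_eq_prod,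
    setIntegral_prod _ (by exact hi.integrableOn)]

end DirDeriv

/-- The source term `∂ₜU + 3U²∂ₓU − ε∂²ₓₓU` of the viscous equation. -/
noncomputable def source (ε : ℝ) (U : ℝ × ℝ → ℝ) (z : ℝ × ℝ) : ℝ :=
  Dt U z + 3 * U z ^ 2 * Dx U z - ε * Dx (Dx U) z

theorem continuous_source {U : ℝ × ℝ → ℝ} (hU : ContDiff ℝ 2 U) (ε : ℝ) :
    Continuous (source ε U) := by
  have h1 := continuous_dirDeriv (hU.of_le (by norm_num)) (1, 0)
  have h2 := contDiff_dirDeriv (m := 1) hU (by norm_num) (0, 1)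
  have h3 := continuous_dirDeriv h2 (0, 1)
  have h4 := hU.continuous
  have h5 := h2.continuous
  unfold source
  fun_prop

/-- The weak form of
`∂ₜη(U) + ∂ₓq(U) = ε∂²ₓₓη(U) − εη″(U)(∂ₓU)² + η′(U)P`. -/
theorem integral_entropy_production {U f : ℝ × ℝ → ℝ} {K : Set (ℝ × ℝ)} {η q : ℝ → ℝ}
    (hU : ContDiff ℝ 2 U) (hη : ContDiff ℝ 2 η)
    (hq : ∀ w, HasDerivAt q (3 * w ^ 2 * deriv η w) w) (hf : ContDiff ℝ 1 f)
    (hK : IsCompact K) (h : ∀ z ∉ K, f z = 0) (ε : ℝ) :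
    ∫ z, (η (U z) * Dt f z + q (U z) * Dx f z) =
      ∫ z, (ε * deriv η (U z) * Dx U z * Dx f z + ε * deriv (deriv η) (U z) * Dx U z ^ 2 * f z
        - deriv η (U z) * source ε U z * f z) := by
  have hη' : ContDiff ℝ 1 (deriv η) := by
    have : ContDiff ℝ (1 + 1) η := by norm_num; exact hη
    exact (contDiff_succ_iff_deriv.1 this).2.2
  have hη'' : Continuous (deriv (deriv η)) := hη'.continuous_deriv (by norm_num)
  have hU1 : ContDiff ℝ 1 U := hU.of_le (by norm_num)
  have hUx : ContDiff ℝ 1 (Dx U) := contDiff_dirDeriv hU (by norm_num) _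
  have hq1 : ContDiff ℝ 1 q := by
    refine contDiff_one_iff_deriv.2 ⟨fun w => (hq w).differentiableAt, ?_⟩
    rw [show deriv q = fun w => 3 * w ^ 2 * deriv η w from funext fun w => (hq w).deriv]
    have := hη'.continuous
    fun_prop
  have hηU : ContDiff ℝ 1 (fun z => η (U z)) := (hη.of_le (by norm_num)).comp hU1
  have hqU : ContDiff ℝ 1 (fun z => q (U z)) := hq1.comp hU1
  have hη'U : ContDiff ℝ 1 (fun z => deriv η (U z)) := hη'.comp hU1
  have hW : ContDiff ℝ 1 (fun z => deriv η (U z) * Dx U z) := hη'U.mul hUx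
  have i1 := integral_mul_dirDeriv hηU hf hK h (1, 0)
  have i2 := integral_mul_dirDeriv hqU hf hK h (0, 1)
  have i3 := integral_mul_dirDeriv hW hf hK h (0, 1)
  have dU : Differentiable ℝ U := hU1.differentiable (by norm_num)
  have e1 : ∀ z, Dt (fun z => η (U z)) z = deriv η (U z) * Dt U z := fun z =>
    dirDeriv_comp (hη.differentiable (by norm_num) _).hasDerivAt (dU z) _
  have e2 : ∀ z, Dx (fun z => q (U z)) z = 3 * U z ^ 2 * deriv η (U z) * Dx U z := fun z =>
    dirDeriv_comp (hq _) (dU z) _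
  have e3 : ∀ z, Dx (fun z => deriv η (U z) * Dx U z) z
      = deriv η (U z) * Dx (Dx U) z + Dx U z * (deriv (deriv η) (U z) * Dx U z) := fun z => by
    rw [dirDeriv_mul (hη'U.differentiable (by norm_num) z) (hUx.differentiable (by norm_num) z),
      dirDeriv_comp (hη'.differentiable (by norm_num) _).hasDerivAt (dU z)]
  simp only [e1, e2, e3] at i1 i2 i3
  have c0 := hf.continuous
  have c1 := continuous_dirDeriv hf (1, 0)
  have c2 := continuous_dirDeriv hf (0, 1)
  have c3 := hηU.continuous
  have c4 := hqU.continuous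
  have c5 := hη'U.continuous
  have c6 := hUx.continuous
  have c7 : Continuous fun z => deriv (deriv η) (U z) := hη''.comp hU1.continuous
  have c8 := continuous_source hU ε
  have c9 := continuous_dirDeriv hUx (0, 1)
  have c10 := continuous_dirDeriv hU1 (1, 0)
  have c11 := hU1.continuous
  have z1 := dirDeriv_eq_zero hK.isClosed h (1, 0)
  have z2 := dirDeriv_eq_zero hK.isClosed h (0, 1)
  have I : ∀ {F : ℝ × ℝ → ℝ}, Continuous F → (∀ z ∉ K, F z = 0) → Integrable F :=
    fun hF h0 => integrable_of_eq_zero_off_compact hF hK h0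
  have a1 : Integrable fun z => η (U z) * Dt f z :=
    I (by fun_prop) (by intro z hz; simp [z1 z hz])
  have a2 : Integrable fun z => q (U z) * Dx f z :=
    I (by fun_prop) (by intro z hz; simp [z2 z hz])
  have a3 : Integrable fun z => deriv η (U z) * Dx U z * Dx f z :=
    I (by fun_prop) (by intro z hz; simp [z2 z hz])
  have b1 : Integrable fun z => deriv η (U z) * Dt U z * f z :=
    I (by fun_prop) (by intro z hz; simp [h z hz])
  have b2 : Integrable fun z => 3 * U z ^ 2 * deriv η (U z) * Dx U z * f z :=
    I (by fun_prop) (by intro z hz; simp [h z hz])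
  have b3 : Integrable fun z =>
      (deriv η (U z) * Dx (Dx U) z + Dx U z * (deriv (deriv η) (U z) * Dx U z)) * f z :=
    I (by fun_prop) (by intro z hz; simp [h z hz])
  have key : ∀ z, ε * deriv η (U z) * Dx U z * Dx f z
      + ε * deriv (deriv η) (U z) * Dx U z ^ 2 * f z - deriv η (U z) * source ε U z * f z
      = ε * (deriv η (U z) * Dx U z * Dx f z)
        + ε * ((deriv η (U z) * Dx (Dx U) z + Dx U z * (deriv (deriv η) (U z) * Dx U z)) * f z)
        - deriv η (U z) * Dt U z * f z - 3 * U z ^ 2 * deriv η (U z) * Dx U z * f z := by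
    intro z; unfold source; ring
  simp only [key]
  have b4 := (a3.const_mul ε).add (b3.const_mul ε)
  rw [integral_sub (f := fun z => _ - _) (b4.sub b1) b2, integral_sub (f := fun z => _ + _) b4 b1,
    integral_add (a3.const_mul ε) (b3.const_mul ε), integral_add a1 a2,
    integral_const_mul, integral_const_mul, i1, i2, i3]
  ring

/-- Local energy estimate: the dissipation is locally controlled by sup bounds on the solution and
on the source term. -/
theorem exists_local_dissipation_bound {χ : ℝ × ℝ → ℝ} {K : Set (ℝ × ℝ)} (hχ : ContDiff ℝ 2 χ)
    (hK : IsCompact K) (h : ∀ z ∉ K, χ z = 0) {M C E : ℝ} (hM : 0 ≤ M) (hE : 0 ≤ E) :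
    ∃ B, ∀ (U : ℝ × ℝ → ℝ) (ε : ℝ), ContDiff ℝ 2 U → 0 < ε → ε ≤ E → (∀ z ∈ K, |U z| ≤ M) →
      (∀ z ∈ K, |source ε U z| ≤ C) → ∫ z, ε * Dx U z ^ 2 * χ z ≤ B := by
  refine ⟨∫ z, (M ^ 2 / 2 * |Dt χ z| + 3 / 4 * M ^ 4 * |Dx χ z| + E * (M ^ 2 / 2) * |Dx (Dx χ) z|
    + M * C * |χ z|), ?_⟩
  intro U ε hU hε hεE hUM hUC
  have hχ1 : ContDiff ℝ 1 χ := hχ.of_le (by norm_num)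
  have hχx : ContDiff ℝ 1 (Dx χ) := contDiff_dirDeriv hχ (by norm_num) _
  have hU1 : ContDiff ℝ 1 U := hU.of_le (by norm_num)
  have z1 := dirDeriv_eq_zero hK.isClosed h (1, 0)
  have z2 := dirDeriv_eq_zero hK.isClosed h (0, 1)
  have z3 := dirDeriv_eq_zero hK.isClosed z2 (0, 1)
  have hsq : ∀ w : ℝ, HasDerivAt (fun w : ℝ => w ^ 2 / 2) w w := fun w => by
    simpa using (hasDerivAt_pow 2 w).div_const 2
  have d1 : deriv (fun w : ℝ => w ^ 2 / 2) = fun w => w := funext fun w => (hsq w).deriv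
  have d2 : deriv (fun w : ℝ => w) = fun _ => 1 := deriv_id''
  have ident := integral_entropy_production (η := fun w => w ^ 2 / 2) (q := fun w => 3 / 4 * w ^ 4)
    hU (by fun_prop) (fun w => by
      rw [d1]
      exact ((hasDerivAt_pow 4 w).const_mul (3 / 4)).congr_deriv (by norm_num; ring)) hχ1 hK h ε
  simp only [d1, d2] at ident
  have hU2 : ContDiff ℝ 1 (fun z => U z ^ 2 / 2) := by fun_prop
  have ibp := integral_mul_dirDeriv hU2 hχx hK z2 (0, 1)
  have e : ∀ z, Dx (fun z => U z ^ 2 / 2) z = U z * Dx U z := fun z =>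
    dirDeriv_comp (hsq _) (hU1.differentiable (by norm_num) z) _
  simp only [e] at ibp
  have c0 := hχ.continuous
  have c1 := continuous_dirDeriv hχ1 (1, 0)
  have c2 := hχx.continuous
  have c3 := continuous_dirDeriv hχx (0, 1)
  have c4 := hU.continuous
  have c5 := continuous_dirDeriv hU1 (0, 1)
  have c6 := continuous_source hU ε
  have I : ∀ {F : ℝ × ℝ → ℝ}, Continuous F → (∀ z ∉ K, F z = 0) → Integrable F :=
    fun hF h0 => integrable_of_eq_zero_off_compact hF hK h0
  have a1 : Integrable fun z => U z ^ 2 / 2 * Dt χ z + 3 / 4 * U z ^ 4 * Dx χ z :=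
    I (by fun_prop) (by intro z hz; simp [z1 z hz, z2 z hz])
  have a2 : Integrable fun z => U z ^ 2 / 2 * Dx (Dx χ) z :=
    I (by fun_prop) (by intro z hz; simp [z3 z hz])
  have a3 : Integrable fun z => U z * source ε U z * χ z :=
    I (by fun_prop) (by intro z hz; simp [h z hz])
  have a4 : Integrable fun z => U z * Dx U z * Dx χ z :=
    I (by fun_prop) (by intro z hz; simp [z2 z hz])
  have a5 : Integrable fun z => ε * Dx U z ^ 2 * χ z :=
    I (by fun_prop) (by intro z hz; simp [h z hz])
  have split : ∫ z, (ε * U z * Dx U z * Dx χ z + ε * 1 * Dx U z ^ 2 * χ z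
      - U z * source ε U z * χ z) = ε * (∫ z, U z * Dx U z * Dx χ z)
        + (∫ z, ε * Dx U z ^ 2 * χ z) - ∫ z, U z * source ε U z * χ z := by
    have b := (a4.const_mul ε).add a5
    rw [← integral_const_mul, ← integral_add (a4.const_mul ε) a5,
      ← integral_sub (f := fun z => _ + _) b a3]
    congr 1; funext z; ring
  have total : ∫ z, ε * Dx U z ^ 2 * χ z = ∫ z, (U z ^ 2 / 2 * Dt χ z + 3 / 4 * U z ^ 4 * Dx χ z
      + ε * (U z ^ 2 / 2 * Dx (Dx χ) z) + U z * source ε U z * χ z) := by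
    have b := a1.add (a2.const_mul ε)
    rw [integral_add (f := fun z => _ + _) b a3, integral_add a1 (a2.const_mul ε),
      integral_const_mul, ibp]
    rw [split] at ident
    linarith
  rw [total]
  refine integral_mono (((a1.add (a2.const_mul ε)).add a3)) (I (by fun_prop) ?_) ?_
  · intro z hz; simp [z1 z hz, z2 z hz, z3 z hz, h z hz]
  · intro z
    by_cases hz : z ∈ K
    · have h1 := hUM z hz
      have h2 := hUC z hz
      have s2 : U z ^ 2 ≤ M ^ 2 := sq_le_sq' (by linarith [neg_abs_le (U z)])
        ((le_abs_self _).trans h1)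
      have s4 : U z ^ 4 ≤ M ^ 4 := by nlinarith [sq_nonneg (U z)]
      have t1 : U z ^ 2 / 2 * Dt χ z ≤ M ^ 2 / 2 * |Dt χ z| := by
        exact (mul_le_mul_of_nonneg_left (le_abs_self _) (by positivity)).trans (by gcongr)
      have t2 : 3 / 4 * U z ^ 4 * Dx χ z ≤ 3 / 4 * M ^ 4 * |Dx χ z| := by
        exact (mul_le_mul_of_nonneg_left (le_abs_self _) (by positivity)).trans (by gcongr)
      have t3 : ε * (U z ^ 2 / 2 * Dx (Dx χ) z) ≤ E * (M ^ 2 / 2) * |Dx (Dx χ) z| := by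
        rw [← mul_assoc]
        exact (mul_le_mul_of_nonneg_left (le_abs_self _) (by positivity)).trans (by gcongr)
      have t4 : U z * source ε U z * χ z ≤ M * C * |χ z| := by
        refine (le_abs_self _).trans ?_
        rw [abs_mul, abs_mul]
        gcongr
      simpa using add_le_add (add_le_add (add_le_add t1 t2) t3) t4
    · simp [z1 z hz, z2 z hz, z3 z hz, h z hz]

theorem abs_one_sub_cos_le (r : ℝ) : |1 - Real.cos r| ≤ |r| := by
  rw [abs_of_nonneg (by linarith [Real.cos_le_one r])]
  have r1 := Real.one_sub_sq_div_two_le_cos (x := r)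
  have r2 := Real.neg_one_le_cos r
  rcases le_total |r| 2 with hr | hr
  · nlinarith [sq_abs r, abs_nonneg r]
  · linarith

theorem abs_integral_one_sub_cos_mul_le {f a b : ℝ × ℝ → ℝ} {K : Set (ℝ × ℝ)} {k m0 m1 : ℝ}
    (hf : ContDiff ℝ 1 f) (ha : Continuous a) (hb : Continuous b) (hK : IsCompact K)
    (h : ∀ z ∉ K, f z = 0) (hm0 : 0 ≤ m0) (hm1 : 0 ≤ m1) (ha0 : ∀ z ∈ K, |a z| ≤ m0)
    (hb0 : ∀ z ∈ K, |b z| ≤ m1) (hk : 0 < k)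
    (hI : ∫ z, (Dt f z ^ 2 + Dx f z ^ 2) ≤ 4) (hJ : ∫ z, f z ^ 2 ≤ k ^ 4) :
    |∫ z, (1 - Real.cos (f z / k)) * (a z * Dt f z + b z * Dx f z)| ≤ (m0 + m1) * 3 * k := by
  have z1 := dirDeriv_eq_zero hK.isClosed h (1, 0)
  have z2 := dirDeriv_eq_zero hK.isClosed h (0, 1)
  have c0 := hf.continuous
  have c1 := continuous_dirDeriv hf (1, 0)
  have c2 := continuous_dirDeriv hf (0, 1)
  have I : ∀ {F : ℝ × ℝ → ℝ}, Continuous F → (∀ z ∉ K, F z = 0) → Integrable F :=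
    fun hF h0 => integrable_of_eq_zero_off_compact hF hK h0
  have iG : Integrable fun z => Dt f z ^ 2 + Dx f z ^ 2 :=
    I (by fun_prop) (by intro z hz; simp [z1 z hz, z2 z hz])
  have iF : Integrable fun z => f z ^ 2 := I (by fun_prop) (by intro z hz; simp [h z hz])
  have b1 := (iG.const_mul (k / 2)).add (iF.const_mul (k⁻¹ ^ 3))
  calc |_| ≤ ∫ z, |_| := abs_integral_le_integral_abs
    _ ≤ ∫ z, (m0 + m1) * (k / 2 * (Dt f z ^ 2 + Dx f z ^ 2) + k⁻¹ ^ 3 * f z ^ 2) := by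
        refine integral_mono (Integrable.abs (I (by fun_prop) ?_)) (b1.const_mul _) ?_
        · intro z hz; simp [z1 z hz, z2 z hz]
        · intro z
          by_cases hz : z ∈ K
          · have u0 := ha0 z hz
            have u3 := hb0 z hz
            have u1 : |1 - Real.cos (f z / k)| ≤ |f z| * k⁻¹ := by
              rw [← div_eq_mul_inv, ← abs_of_pos hk, ← abs_div, abs_of_pos hk]
              exact abs_one_sub_cos_le _
            have hs : 0 < k⁻¹ := inv_pos.2 hk
            have hks : k * k⁻¹ = 1 := mul_inv_cancel₀ hk.ne'
            set s := k⁻¹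
            have amgm : ∀ y, |f z| * s * |y| ≤ k / 2 * y ^ 2 + s ^ 3 * f z ^ 2 / 2 := by
              intro y
              have e : k / 2 * (|y| - s ^ 2 * |f z|) ^ 2
                  = k / 2 * y ^ 2 - |f z| * s * |y| + s ^ 3 * f z ^ 2 / 2 := by
                rw [← sq_abs y, ← sq_abs (f z)]
                linear_combination (-|y| * s * |f z| + s ^ 3 * |f z| ^ 2 / 2) * hks
              have : 0 ≤ k / 2 * (|y| - s ^ 2 * |f z|) ^ 2 := by positivity
              linarith
            have v1 : |a z * Dt f z + b z * Dx f z| ≤ (m0 + m1) * (|Dt f z| + |Dx f z|) := by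
              refine (abs_add_le _ _).trans ?_
              rw [abs_mul, abs_mul]
              have := mul_le_mul_of_nonneg_right u0 (abs_nonneg (Dt f z))
              have := mul_le_mul_of_nonneg_right u3 (abs_nonneg (Dx f z))
              have := mul_nonneg hm0 (abs_nonneg (Dx f z))
              have := mul_nonneg hm1 (abs_nonneg (Dt f z))
              linarith
            simp only [abs_mul]
            calc _ ≤ (|f z| * s) * ((m0 + m1) * (|Dt f z| + |Dx f z|)) := by gcongr
              _ = (m0 + m1) * (|f z| * s * |Dt f z| + |f z| * s * |Dx f z|) := by ring
              _ ≤ _ := by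
                refine mul_le_mul_of_nonneg_left ?_ (by positivity)
                have := amgm (Dt f z)
                have := amgm (Dx f z)
                linarith
          · simp [h z hz, z1 z hz, z2 z hz]
    _ = (m0 + m1) * (k / 2 * (∫ z, (Dt f z ^ 2 + Dx f z ^ 2)) + k⁻¹ ^ 3 * ∫ z, f z ^ 2) := by
        rw [integral_const_mul, integral_add (iG.const_mul _) (iF.const_mul _),
          integral_const_mul, integral_const_mul]
    _ ≤ (m0 + m1) * (k / 2 * 4 + k⁻¹ ^ 3 * k ^ 4) := by gcongr
    _ = _ := by field_simp; ring

set_option maxHeartbeats 1000000 in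
/-- Murat-type interpolation estimate for the entropy production: up to `O(√ε)`, its action on a
bounded set of `H¹₀` is controlled by the `L²` norm of the test function. -/
theorem exists_entropy_production_bound {χ : ℝ × ℝ → ℝ} {K K' : Set (ℝ × ℝ)} {η q : ℝ → ℝ}
    (hη : ContDiff ℝ 2 η) (hq : ∀ w, HasDerivAt q (3 * w ^ 2 * deriv η w) w)
    (hχ : ContDiff ℝ 2 χ) (hK : IsCompact K) (hK' : IsCompact K') (hKK' : K ⊆ K')
    (h : ∀ z ∉ K', χ z = 0) (h0 : ∀ z, 0 ≤ χ z) (h1 : ∀ z ∈ K, χ z = 1)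
    {M C E : ℝ} (hM : 0 ≤ M) (hC : 0 ≤ C) (hE : 0 ≤ E) :
    ∃ A, 0 < A ∧ ∀ (U : ℝ × ℝ → ℝ) (ε : ℝ), ContDiff ℝ 2 U → 0 < ε → ε ≤ E →
      (∀ z ∈ K', |U z| ≤ M) → (∀ z ∈ K', |source ε U z| ≤ C) →
      ∀ (f : ℝ × ℝ → ℝ) (k : ℝ), ContDiff ℝ 1 f → (∀ z ∉ K, f z = 0) → 0 < k →
        ∫ z, (Dt f z ^ 2 + Dx f z ^ 2) ≤ 4 → ∫ z, f z ^ 2 ≤ k ^ 4 →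
        |∫ z, (η (U z) * Dt f z + q (U z) * Dx f z)| ≤ A * (√ε + k) := by
  obtain ⟨B, hB⟩ := exists_local_dissipation_bound hχ hK' h hM hE
  have hη' : ContDiff ℝ 1 (deriv η) := by
    have : ContDiff ℝ (1 + 1) η := by norm_num; exact hη
    exact (contDiff_succ_iff_deriv.1 this).2.2
  have hη'' : Continuous (deriv (deriv η)) := hη'.continuous_deriv (by norm_num)
  have hqc : Continuous q := continuous_iff_continuousAt.2 fun w => (hq w).continuousAt
  have bound : ∀ g : ℝ → ℝ, Continuous g → ∃ m, 0 ≤ m ∧ ∀ w, |w| ≤ M → |g w| ≤ m := by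
    intro g hg
    obtain ⟨m, hm⟩ := (isCompact_Icc (a := -M) (b := M)).exists_bound_of_continuousOn
      hg.continuousOn
    exact ⟨|m|, abs_nonneg _, fun w hw => (hm w (abs_le.1 hw)).trans (le_abs_self _)⟩
  obtain ⟨m0, hm0, H0⟩ := bound η hη.continuous
  obtain ⟨m1, hm1, H1⟩ := bound _ hη'.continuous
  obtain ⟨m2, hm2, H2⟩ := bound _ hη''
  obtain ⟨m3, hm3, H3⟩ := bound q hqc
  have hX0 : 0 ≤ ∫ z, χ z := integral_nonneg h0
  set X := ∫ z, χ z
  refine ⟨m1 * (|B| + 4) + m2 * |B| + m1 * C * X + (m0 + m3) * 3 + 1, by positivity, ?_⟩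
  intro U ε hU hε hεE hUM hUC f k hf hfK hk hI hJ
  have hEn := (hB U ε hU hε hεE hUM hUC).trans (le_abs_self B)
  have hU1 : ContDiff ℝ 1 U := hU.of_le (by norm_num)
  set g : ℝ × ℝ → ℝ := fun z => k * Real.sin (f z / k)
  have hg : ContDiff ℝ 1 g := contDiff_const.mul (Real.contDiff_sin.comp (hf.div_const k))
  have hgK : ∀ z ∉ K, g z = 0 := fun z hz => by simp [g, hfK z hz]
  have hgD : ∀ v z, dirDeriv v g z = Real.cos (f z / k) * dirDeriv v f z := by
    intro v z
    refine dirDeriv_comp (h := fun s => k * Real.sin (s / k)) ?_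
      (hf.differentiable (by norm_num) z) v
    have := (((hasDerivAt_id (f z)).div_const k).sin).const_mul k
    exact this.congr_deriv (by simp only [id]; field_simp)
  have ident := integral_entropy_production hU hη hq hg hK hgK ε
  have z0 := hfK
  have z1 := dirDeriv_eq_zero hK.isClosed hfK (1, 0)
  have z2 := dirDeriv_eq_zero hK.isClosed hfK (0, 1)
  have y1 := dirDeriv_eq_zero hK.isClosed hgK (1, 0)
  have y2 := dirDeriv_eq_zero hK.isClosed hgK (0, 1)
  have c0 := hf.continuous
  have c1 := continuous_dirDeriv hf (1, 0)
  have c2 := continuous_dirDeriv hf (0, 1)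
  have c3 := hg.continuous
  have c4 := continuous_dirDeriv hg (1, 0)
  have c5 := continuous_dirDeriv hg (0, 1)
  have c6 := hU.continuous
  have c7 := continuous_dirDeriv hU1 (0, 1)
  have c8 := continuous_source hU ε
  have c9 := hχ.continuous
  have c10 : Continuous fun z => η (U z) := hη.continuous.comp c6
  have c11 : Continuous fun z => q (U z) := hqc.comp c6
  have c12 : Continuous fun z => deriv η (U z) := hη'.continuous.comp c6
  have c13 : Continuous fun z => deriv (deriv η) (U z) := hη''.comp c6
  have I : ∀ {F : ℝ × ℝ → ℝ}, Continuous F → (∀ z ∉ K, F z = 0) → Integrable F :=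
    fun hF h0 => integrable_of_eq_zero_off_compact hF hK h0
  have I' : ∀ {F : ℝ × ℝ → ℝ}, Continuous F → (∀ z ∉ K', F z = 0) → Integrable F :=
    fun hF h0 => integrable_of_eq_zero_off_compact hF hK' h0
  have iG : Integrable fun z => Dt f z ^ 2 + Dx f z ^ 2 :=
    I (by fun_prop) (by intro z hz; simp [z1 z hz, z2 z hz])
  have iF : Integrable fun z => f z ^ 2 := I (by fun_prop) (by intro z hz; simp [z0 z hz])
  have iE : Integrable fun z => ε * Dx U z ^ 2 * χ z :=
    I' (by fun_prop) (by intro z hz; simp [h z hz])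
  have iχ : Integrable χ := I' c9 h
  have hsε : 0 < √ε := Real.sqrt_pos.2 hε
  have hsq : √ε ^ 2 = ε := Real.sq_sqrt hε.le
  -- the part of the test function bounded by `k`
  have part1 : |∫ z, (η (U z) * Dt g z + q (U z) * Dx g z)|
      ≤ (m1 * √ε + m2 * k) * |B| + m1 * √ε * 4 + m1 * C * k * X := by
    rw [ident]
    have b1 := (iE.const_mul (m1 * √ε + m2 * k)).add (iG.const_mul (m1 * √ε))
    calc |_| ≤ ∫ z, |_| := abs_integral_le_integral_abs
      _ ≤ ∫ z, ((m1 * √ε + m2 * k) * (ε * Dx U z ^ 2 * χ z)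
            + m1 * √ε * (Dt f z ^ 2 + Dx f z ^ 2) + m1 * C * k * χ z) := by
          refine integral_mono (Integrable.abs (I (by fun_prop) ?_))
            (b1.add (iχ.const_mul (m1 * C * k))) ?_
          · intro z hz; simp [hgK z hz, y2 z hz]
          · intro z
            by_cases hz : z ∈ K
            · have u1 := H1 _ (hUM z (hKK' hz))
              have u2 := H2 _ (hUM z (hKK' hz))
              have u3 := hUC z (hKK' hz)
              have u4 : |g z| ≤ k := by
                simp only [g, abs_mul, abs_of_pos hk]
                have := Real.abs_sin_le_one (f z / k)
                nlinarith
              have u5 : |Dx g z| ≤ |Dx f z| := by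
                rw [hgD, abs_mul]
                have := Real.abs_cos_le_one (f z / k)
                have := abs_nonneg (Dx f z)
                nlinarith
              have t1 : |ε * deriv η (U z) * Dx U z * Dx g z|
                  ≤ m1 * √ε * (ε * Dx U z ^ 2) + m1 * √ε * (Dt f z ^ 2 + Dx f z ^ 2) := by
                have : |ε * deriv η (U z) * Dx U z * Dx g z| ≤ ε * m1 * |Dx U z| * |Dx f z| := by
                  rw [abs_mul, abs_mul, abs_mul, abs_of_pos hε]
                  gcongr
                refine this.trans ?_
                have k1 : √ε * |Dx U z| * |Dx f z| ≤
                    ε * Dx U z ^ 2 + (Dt f z ^ 2 + Dx f z ^ 2) := by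
                  have e1 := sq_abs (Dx U z)
                  have e2 := sq_abs (Dx f z)
                  rw [← e1, ← e2]
                  nth_rewrite 2 [← hsq]
                  nlinarith [sq_nonneg (√ε * |Dx U z| - |Dx f z|), sq_nonneg (Dt f z),
                    sq_nonneg (√ε * |Dx U z|), sq_nonneg (|Dx f z|)]
                calc ε * m1 * |Dx U z| * |Dx f z|
                    = m1 * √ε * (√ε * |Dx U z| * |Dx f z|) := by
                      nth_rewrite 1 [← hsq]; ring
                  _ ≤ m1 * √ε * (ε * Dx U z ^ 2 + (Dt f z ^ 2 + Dx f z ^ 2)) := by gcongr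
                  _ = _ := by ring
              have t2 : |ε * deriv (deriv η) (U z) * Dx U z ^ 2 * g z|
                  ≤ m2 * k * (ε * Dx U z ^ 2) := by
                rw [abs_mul, abs_mul, abs_mul, abs_of_pos hε, abs_of_nonneg (sq_nonneg (Dx U z))]
                calc _ ≤ ε * m2 * Dx U z ^ 2 * k := by gcongr
                  _ = _ := by ring
              have t3 : |deriv η (U z) * source ε U z * g z| ≤ m1 * C * k := by
                rw [abs_mul, abs_mul]
                gcongr
              have := (abs_sub _ _).trans (add_le_add
                ((abs_add_le _ _).trans (add_le_add t1 t2)) t3)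
              simp only [h1 z hz, mul_one]
              linarith
            · have := h0 z
              simp only [hgK z hz, y2 z hz, z1 z hz, z2 z hz]
              simp only [mul_zero, add_zero, sub_zero, abs_zero]
              positivity
      _ = (m1 * √ε + m2 * k) * (∫ z, ε * Dx U z ^ 2 * χ z)
            + m1 * √ε * (∫ z, (Dt f z ^ 2 + Dx f z ^ 2)) + m1 * C * k * X := by
          rw [integral_add (f := fun z => _ + _) b1 (iχ.const_mul _),
            integral_add (iE.const_mul _) (iG.const_mul _), integral_const_mul, integral_const_mul,
            integral_const_mul]
      _ ≤ _ := by gcongr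
  have part2 := abs_integral_one_sub_cos_mul_le hf c10 c11 hK hfK hm0 hm3
    (fun z hz => H0 _ (hUM z (hKK' hz))) (fun z hz => H3 _ (hUM z (hKK' hz))) hk hI hJ
  have sum : ∫ z, (η (U z) * Dt f z + q (U z) * Dx f z) =
      (∫ z, (η (U z) * Dt g z + q (U z) * Dx g z))
        + ∫ z, (1 - Real.cos (f z / k)) * (η (U z) * Dt f z + q (U z) * Dx f z) := by
    rw [← integral_add]
    · congr 1; funext z; rw [hgD, hgD]; ring
    · exact I (by fun_prop) (by intro z hz; simp [y1 z hz, y2 z hz])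
    · exact I (by fun_prop) (by intro z hz; simp [z1 z hz, z2 z hz])
  rw [sum]
  refine ((abs_add_le _ _).trans (add_le_add part1 part2)).trans ?_
  have := abs_nonneg B
  have p1 : 0 ≤ m2 * |B| * √ε := by positivity
  have p2 : 0 ≤ m1 * C * X * √ε := by positivity
  have p3 : 0 ≤ (m0 + m3) * √ε := by positivity
  have p4 : 0 ≤ m1 * (|B| + 4) * k := by positivity
  nlinarith

section Rellich

variable {f : ℝ × ℝ → ℝ} {K : Set (ℝ × ℝ)}

theorem abs_integral_sub_le_rectangle (hf : ContDiff ℝ 1 f) (hK : IsCompact K)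
    (h : ∀ z ∉ K, f z = 0) (t t' c d : ℝ) {a : ℝ} (ha : 0 < a) :
    |∫ y in c..d, (f (t, y) - f (t', y))|
      ≤ a / 2 * (|t - t'| * |d - c|) + 1 / (2 * a) * ∫ z, Dt f z ^ 2 := by
  have c0 := hf.continuous
  have c1 := continuous_dirDeriv hf (1, 0)
  have z1 := dirDeriv_eq_zero hK.isClosed h (1, 0)
  have hd : ∀ s y, HasDerivAt (fun s => f (s, y)) (Dt f (s, y)) s := by
    intro s y
    have h2 : HasFDerivAt (fun s : ℝ => (s, y)) (ContinuousLinearMap.inl ℝ ℝ ℝ) s :=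
      hasFDerivAt_prodMk_left s y
    have := ((hf.differentiable (by norm_num) (s, y)).hasFDerivAt.comp s h2).hasDerivAt
    simpa [dirDeriv, Function.comp_def] using this
  have ftc : ∀ y, f (t, y) - f (t', y) = ∫ s in t'..t, Dt f (s, y) := fun y =>
    (intervalIntegral.integral_eq_sub_of_hasDerivAt (fun s _ => hd s y)
      (Continuous.intervalIntegrable (by fun_prop) _ _)).symm
  have iS : Integrable fun z => Dt f z ^ 2 :=
    integrable_of_eq_zero_off_compact (by fun_prop) hK (by intro z hz; simp [z1 z hz])
  have iA : Integrable fun z => |Dt f z| :=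
    integrable_of_eq_zero_off_compact (by fun_prop) hK (by intro z hz; simp [z1 z hz])
  set A := uIoc t' t
  set B := uIoc c d
  have iR : Integrable (fun z => |Dt f z|) ((volume.restrict A).prod (volume.restrict B)) := by
    rw [Measure.prod_restrict]; exact iA.integrableOn
  have volA : volume.real A = |t - t'| := by
    simp [A, uIoc, measureReal_def, max_sub_min_eq_abs]
  have volB : volume.real B = |d - c| := by
    simp [B, uIoc, measureReal_def, max_sub_min_eq_abs]
  have volAB : volume.real (A ×ˢ B) = |t - t'| * |d - c| := by
    rw [← volA, ← volB, Measure.volume_eq_prod, measureReal_prod_prod]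
  have finAB : volume (A ×ˢ B) ≠ ⊤ := by
    rw [Measure.volume_eq_prod, Measure.prod_prod]
    exact ENNReal.mul_ne_top (by simp [A, uIoc]) (by simp [B, uIoc])
  have nint : ∀ (g : ℝ → ℝ) (c d : ℝ), |∫ y in c..d, g y| ≤ ∫ y in uIoc c d, |g y| :=
    fun g c d => intervalIntegral.norm_integral_le_integral_norm_uIoc (f := g) (μ := volume)
  have iC : Integrable (fun _ : ℝ × ℝ => a / 2) (volume.restrict (A ×ˢ B)) :=
    integrableOn_const finAB
  have iS' : Integrable (fun z => 1 / (2 * a) * Dt f z ^ 2) (volume.restrict (A ×ˢ B)) :=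
    (iS.const_mul _).integrableOn
  calc |∫ y in c..d, (f (t, y) - f (t', y))| ≤ ∫ y in B, |f (t, y) - f (t', y)| :=
        nint _ c d
    _ ≤ ∫ y in B, ∫ s in A, |Dt f (s, y)| := by
        refine integral_mono ?_ iR.integral_prod_right fun y => ?_
        · exact (Continuous.intervalIntegrable (by fun_prop) c d).def'
        · simp only [ftc y]
          exact nint _ t' t
    _ = ∫ z in A ×ˢ B, |Dt f z| := by
        rw [Measure.volume_eq_prod, ← Measure.prod_restrict]
        exact (integral_prod_symm _ iR).symm
    _ ≤ ∫ z in A ×ˢ B, (a / 2 + 1 / (2 * a) * Dt f z ^ 2) := by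
        refine integral_mono iA.integrableOn
          (iC.add iS') fun z => ?_
        have e : a / 2 + 1 / (2 * a) * Dt f z ^ 2 - |Dt f z| = (a - |Dt f z|) ^ 2 / (2 * a) := by
          rw [← sq_abs (Dt f z)]; field_simp; ring
        have : 0 ≤ (a - |Dt f z|) ^ 2 / (2 * a) := by positivity
        simp only
        linarith
    _ = a / 2 * (|t - t'| * |d - c|) + 1 / (2 * a) * ∫ z in A ×ˢ B, Dt f z ^ 2 := by
        rw [integral_add iC iS',
          integral_const_mul, setIntegral_const, volAB, smul_eq_mul]
        ring
    _ ≤ _ := by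
        gcongr
        · exact ae_of_all _ fun z => sq_nonneg _
        · exact Measure.restrict_le_self

theorem integral_sq_le_of_abs_primitive_le (hf : ContDiff ℝ 1 f) (hK : IsCompact K)
    (h : ∀ z ∉ K, f z = 0) {σ : ℝ}
    (hσ : ∀ z ∈ K, |∫ y in (0 : ℝ)..z.2, f (z.1, y)| ≤ σ) :
    ∫ z, f z ^ 2 ≤ σ * ∫ z, |Dx f z| := by
  have c0 := hf.continuous
  have c1 := continuous_dirDeriv hf (0, 1)
  have z1 := dirDeriv_eq_zero hK.isClosed h (0, 1)
  have iS : Integrable fun z => f z ^ 2 :=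
    integrable_of_eq_zero_off_compact (by fun_prop) hK (by intro z hz; simp [h z hz])
  have iA : Integrable fun z => |Dx f z| :=
    integrable_of_eq_zero_off_compact (by fun_prop) hK (by intro z hz; simp [z1 z hz])
  have hK2 : IsCompact (Prod.snd '' K) := hK.image continuous_snd
  have off : ∀ t x, x ∉ Prod.snd '' K → (t, x) ∉ K := fun t x hx hz => hx ⟨_, hz, rfl⟩
  have I : ∀ {g : ℝ → ℝ}, Continuous g → (∀ x ∉ Prod.snd '' K, g x = 0) → Integrable g :=
    fun hg h0 => hg.integrable_of_hasCompactSupport (HasCompactSupport.intro hK2 h0)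
  have slice : ∀ t, ∫ x, f (t, x) ^ 2 ≤ σ * ∫ x, |Dx f (t, x)| := by
    intro t
    have hd : ∀ x, HasDerivAt (fun x => f (t, x)) (Dx f (t, x)) x := by
      intro x
      have h2 : HasFDerivAt (fun y : ℝ => (t, y)) (ContinuousLinearMap.inr ℝ ℝ ℝ) x :=
        hasFDerivAt_prodMk_right t x
      have := ((hf.differentiable (by norm_num) (t, x)).hasFDerivAt.comp x h2).hasDerivAt
      simpa [dirDeriv, Function.comp_def] using this
    have hψ : ∀ x, HasDerivAt (fun x => ∫ y in (0 : ℝ)..x, f (t, y)) (f (t, x)) x := fun x =>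
      (Continuous.integral_hasStrictDerivAt (f := fun y => f (t, y)) (by fun_prop) 0 x).hasDerivAt
    have cψ : Continuous fun x => ∫ y in (0 : ℝ)..x, f (t, y) :=
      continuous_iff_continuousAt.2 fun x => (hψ x).continuousAt
    have i3 : Integrable fun x => Dx f (t, x) * ∫ y in (0 : ℝ)..x, f (t, y) :=
      I (by fun_prop) fun x hx => by simp [z1 _ (off t x hx)]
    have ibp := integral_mul_deriv_eq_deriv_mul_of_integrable (fun x _ => hd x) (fun x _ => hψ x)
      (I (by fun_prop) fun x hx => by simp [h _ (off t x hx)]) i3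
      (I (by fun_prop) fun x hx => by simp [h _ (off t x hx)])
    calc ∫ x, f (t, x) ^ 2 = ∫ x, -(Dx f (t, x) * ∫ y in (0 : ℝ)..x, f (t, y)) := by
          rw [integral_neg, ← ibp]; simp only [pow_two]
      _ ≤ ∫ x, σ * |Dx f (t, x)| := by
          refine integral_mono i3.neg (I (by fun_prop) fun x hx => by simp [z1 _ (off t x hx)]) ?_
          intro x
          by_cases hx : (t, x) ∈ K
          · have h1 := hσ _ hx
            refine (neg_le_abs _).trans ?_
            rw [abs_mul, mul_comm]
            exact mul_le_mul_of_nonneg_right h1 (abs_nonneg _)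
          · simp [z1 _ hx]
      _ = _ := integral_const_mul _ _
  rw [Measure.volume_eq_prod] at iS iA ⊢
  rw [integral_prod _ iS, integral_prod _ iA, ← integral_const_mul]
  exact integral_mono iS.integral_prod_left (iA.integral_prod_left.const_mul σ) slice

/-- The unit ball of `H¹₀`, restricted to `C¹` functions vanishing off `K`. -/
def testBall (K : Set (ℝ × ℝ)) : Set (ℝ × ℝ → ℝ) :=
  {f | ContDiff ℝ 1 f ∧ (∀ z ∉ K, f z = 0) ∧ ∫ z, (f z ^ 2 + Dt f z ^ 2 + Dx f z ^ 2) ≤ 1}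

theorem integral_sq_Dt_Dx_le_of_mem_testBall (hK : IsCompact K) (hf : f ∈ testBall K) :
    ∫ z, (Dt f z ^ 2 + Dx f z ^ 2) ≤ 1 := by
  obtain ⟨hf, h, h1⟩ := hf
  have c0 := hf.continuous
  have c1 := continuous_dirDeriv hf (1, 0)
  have c2 := continuous_dirDeriv hf (0, 1)
  have z1 := dirDeriv_eq_zero hK.isClosed h (1, 0)
  have z2 := dirDeriv_eq_zero hK.isClosed h (0, 1)
  refine (integral_mono ?_ ?_ fun z => ?_).trans h1
  · exact integrable_of_eq_zero_off_compact (by fun_prop) hK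
      (by intro z hz; simp [z1 z hz, z2 z hz])
  · exact integrable_of_eq_zero_off_compact (by fun_prop) hK
      (by intro z hz; simp [z1 z hz, z2 z hz, h z hz])
  · have := sq_nonneg (f z)
    simp only
    linarith

theorem integral_sq_Dt_Dx_sub_le {g : ℝ × ℝ → ℝ} (hK : IsCompact K) (hf : f ∈ testBall K)
    (hg : g ∈ testBall K) :
    ∫ z, (Dt (fun z => f z - g z) z ^ 2 + Dx (fun z => f z - g z) z ^ 2) ≤ 4 := by
  have h1 := integral_sq_Dt_Dx_le_of_mem_testBall hK hf
  have h2 := integral_sq_Dt_Dx_le_of_mem_testBall hK hg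
  obtain ⟨hf, hf0, -⟩ := hf
  obtain ⟨hg, hg0, -⟩ := hg
  have c1 := continuous_dirDeriv hf (1, 0)
  have c2 := continuous_dirDeriv hf (0, 1)
  have c3 := continuous_dirDeriv hg (1, 0)
  have c4 := continuous_dirDeriv hg (0, 1)
  have z1 := dirDeriv_eq_zero hK.isClosed hf0 (1, 0)
  have z2 := dirDeriv_eq_zero hK.isClosed hf0 (0, 1)
  have z3 := dirDeriv_eq_zero hK.isClosed hg0 (1, 0)
  have z4 := dirDeriv_eq_zero hK.isClosed hg0 (0, 1)
  have e : ∀ v z, dirDeriv v (fun z => f z - g z) z = dirDeriv v f z - dirDeriv v g z :=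
    fun v z => dirDeriv_sub (hf.differentiable (by norm_num) z)
      (hg.differentiable (by norm_num) z) v
  simp only [e]
  have i1 : Integrable fun z => Dt f z ^ 2 + Dx f z ^ 2 :=
    integrable_of_eq_zero_off_compact (by fun_prop) hK (by intro z hz; simp [z1 z hz, z2 z hz])
  have i2 : Integrable fun z => Dt g z ^ 2 + Dx g z ^ 2 :=
    integrable_of_eq_zero_off_compact (by fun_prop) hK (by intro z hz; simp [z3 z hz, z4 z hz])
  calc _ ≤ ∫ z, (2 * (Dt f z ^ 2 + Dx f z ^ 2) + 2 * (Dt g z ^ 2 + Dx g z ^ 2)) := by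
        refine integral_mono ?_ ((i1.const_mul 2).add (i2.const_mul 2)) fun z => ?_
        · exact integrable_of_eq_zero_off_compact (by fun_prop) hK
            (by intro z hz; simp [z1 z hz, z2 z hz, z3 z hz, z4 z hz])
        · simp only
          nlinarith [sq_nonneg (Dt f z + Dt g z), sq_nonneg (Dx f z + Dx g z)]
    _ = 2 * (∫ z, (Dt f z ^ 2 + Dx f z ^ 2)) + 2 * ∫ z, (Dt g z ^ 2 + Dx g z ^ 2) := by
        rw [integral_add (i1.const_mul 2) (i2.const_mul 2), integral_const_mul, integral_const_mul]
    _ ≤ 4 := by linarith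

theorem integral_sq_Dt_le (hf : ContDiff ℝ 1 f) (hK : IsCompact K) (h : ∀ z ∉ K, f z = 0) :
    ∫ z, Dt f z ^ 2 ≤ ∫ z, (Dt f z ^ 2 + Dx f z ^ 2) := by
  have c1 := continuous_dirDeriv hf (1, 0)
  have c2 := continuous_dirDeriv hf (0, 1)
  have z1 := dirDeriv_eq_zero hK.isClosed h (1, 0)
  have z2 := dirDeriv_eq_zero hK.isClosed h (0, 1)
  refine integral_mono ?_ ?_ fun z => le_add_of_nonneg_right (sq_nonneg _)
  · exact integrable_of_eq_zero_off_compact (by fun_prop) hK (by intro z hz; simp [z1 z hz])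
  · exact integrable_of_eq_zero_off_compact (by fun_prop) hK
      (by intro z hz; simp [z1 z hz, z2 z hz])

theorem integral_abs_Dx_le (hf : ContDiff ℝ 1 f) (hK : IsCompact K) (h : ∀ z ∉ K, f z = 0) :
    ∫ z, |Dx f z| ≤ volume.real K + ∫ z, (Dt f z ^ 2 + Dx f z ^ 2) := by
  have c1 := continuous_dirDeriv hf (1, 0)
  have c2 := continuous_dirDeriv hf (0, 1)
  have z1 := dirDeriv_eq_zero hK.isClosed h (1, 0)
  have z2 := dirDeriv_eq_zero hK.isClosed h (0, 1)
  have i1 : Integrable (K.indicator fun _ => (1 : ℝ)) :=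
    (integrable_indicator_iff hK.measurableSet).2 (integrableOn_const hK.measure_lt_top.ne)
  have i2 : Integrable fun z => Dt f z ^ 2 + Dx f z ^ 2 :=
    integrable_of_eq_zero_off_compact (by fun_prop) hK (by intro z hz; simp [z1 z hz, z2 z hz])
  calc _ ≤ ∫ z, (K.indicator (fun _ => (1 : ℝ)) z + (Dt f z ^ 2 + Dx f z ^ 2)) := by
        refine integral_mono ?_ (i1.add i2) fun z => ?_
        · exact integrable_of_eq_zero_off_compact (by fun_prop) hK
            (by intro z hz; simp [z2 z hz])
        · by_cases hz : z ∈ K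
          · simp only [indicator_of_mem hz]
            nlinarith [sq_abs (Dx f z), sq_nonneg (|Dx f z| - 1), sq_nonneg (Dt f z)]
          · simp [hz, z1 z hz, z2 z hz]
    _ = _ := by
        rw [integral_add i1 i2, integral_indicator hK.measurableSet, setIntegral_const]
        simp

/-- Rellich's theorem: the unit ball of `H¹₀` is totally bounded in `L²`. -/
theorem exists_finite_net_testBall {T : ℝ} (hK : IsCompact K)
    (hKT : K ⊆ Ioo (0 : ℝ) T ×ˢ Ioi (0 : ℝ)) {ρ : ℝ} (hρ : 0 < ρ) :
    ∃ N ⊆ testBall K, N.Finite ∧ ∀ f ∈ testBall K, ∃ g ∈ N, ∫ z, (f z - g z) ^ 2 ≤ ρ := by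
  obtain ⟨R, hR0, hR⟩ : ∃ R, 0 < R ∧ ∀ z ∈ K, |z.1| ≤ R ∧ |z.2| ≤ R := by
    obtain ⟨R, hR0, hR⟩ := hK.isBounded.exists_pos_norm_le
    exact ⟨R, hR0, fun z hz => ⟨(norm_fst_le z).trans (hR z hz), (norm_snd_le z).trans (hR z hz)⟩⟩
  set V := volume.real K
  have hV : 0 ≤ V := measureReal_nonneg
  set σ := ρ / (V + 4)
  have hσ : 0 < σ := by positivity
  set a := 16 / σ
  have ha : 0 < a := by positivity
  set r := σ / (4 * a * R)
  have hr : 0 < r := by positivity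
  -- increments of the primitive in the space variable
  have incr : ∀ f, ContDiff ℝ 1 f → (∀ z ∉ K, f z = 0) → ∀ z ∈ K, ∀ w ∈ K, ∀ b, 0 < b →
      |(∫ y in (0 : ℝ)..z.2, f (z.1, y)) - ∫ y in (0 : ℝ)..w.2, f (w.1, y)|
        ≤ b / 2 * (R * (|z.1 - w.1| + |z.2 - w.2|)) + 1 / b * ∫ z, Dt f z ^ 2 := by
    intro f hf h z hz w hw b hb
    have c0 := hf.continuous
    have h1 := abs_integral_sub_le_rectangle hf hK h z.1 w.1 0 z.2 hb
    have h2 := abs_integral_sub_le_rectangle hf hK h w.1 0 w.2 z.2 hb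
    have f0 : ∀ y, f (0, y) = 0 := fun y => h _ fun hy => lt_irrefl _ (hKT hy).1.1
    have ii : ∀ t c d, IntervalIntegrable (fun y => f (t, y)) volume c d := fun t c d =>
      Continuous.intervalIntegrable (by fun_prop) c d
    simp only [f0, sub_zero] at h1 h2
    rw [intervalIntegral.integral_sub (ii _ _ _) (ii _ _ _)] at h1
    rw [← intervalIntegral.integral_interval_sub_left (ii w.1 0 z.2) (ii w.1 0 w.2)] at h2
    have h3 : b / 2 * (|z.1 - w.1| * |z.2|) ≤ b / 2 * (|z.1 - w.1| * R) := by
      gcongr; exact (hR z hz).2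
    have h4 : b / 2 * (|w.1| * |z.2 - w.2|) ≤ b / 2 * (R * |z.2 - w.2|) := by
      gcongr; exact (hR w hw).1
    have h5 : 1 / (2 * b) = 1 / b / 2 := by field_simp
    rw [h5] at h1 h2
    refine (abs_sub_le _ (∫ y in (0 : ℝ)..z.2, f (w.1, y)) _).trans ?_
    linarith
  obtain ⟨Z, hZK, hZf, hZ⟩ := hK.finite_cover_balls hr
  have := hZf.fintype
  set Θ : (ℝ × ℝ → ℝ) → Z → ℝ := fun f z => ∫ y in (0 : ℝ)..z.1.2, f (z.1.1, y)
  have hTB : TotallyBounded (Θ '' testBall K) := by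
    refine (isCompact_closedBall (0 : Z → ℝ) (R * R + 1)).totallyBounded.subset ?_
    rintro _ ⟨f, hf, rfl⟩
    rw [mem_closedBall_zero_iff, pi_norm_le_iff_of_nonneg (by positivity)]
    intro z
    have hz := hZK z.2
    have h1 := abs_integral_sub_le_rectangle hf.1 hK hf.2.1 z.1.1 0 0 z.1.2 one_pos
    have f0 : ∀ y, f (0, y) = 0 := fun y => hf.2.1 _ fun hy => lt_irrefl _ (hKT hy).1.1
    simp only [f0, sub_zero] at h1
    refine h1.trans ?_
    have h2 : |z.1.1| * |z.1.2| ≤ R * R := by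
      gcongr
      · exact (hR _ hz).1
      · exact (hR _ hz).2
    have h3 : ∫ z, Dt f z ^ 2 ≤ 1 :=
      (integral_sq_Dt_le hf.1 hK hf.2.1).trans (integral_sq_Dt_Dx_le_of_mem_testBall hK hf)
    linarith [mul_pos hR0 hR0]
  obtain ⟨N, hNS, hNf, hN⟩ := exists_subset_image_finite_and.1
    (totallyBounded_iff_subset.1 hTB _ (Metric.dist_mem_uniformity (half_pos hσ)))
  refine ⟨N, hNS, hNf, fun f hf => ?_⟩
  have hfN := hN (mem_image_of_mem Θ hf)
  simp only [mem_iUnion, mem_image, exists_prop, mem_ofPred_eq] at hfN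
  obtain ⟨_, ⟨g, hg, rfl⟩, hfg⟩ := hfN
  refine ⟨g, hg, ?_⟩
  have hg' := hNS hg
  have hI := integral_sq_Dt_Dx_sub_le hK hf hg'
  have hd : ContDiff ℝ 1 fun z => f z - g z := hf.1.sub hg'.1
  have hd0 : ∀ z ∉ K, f z - g z = 0 := fun z hz => by rw [hf.2.1 z hz, hg'.2.1 z hz, sub_zero]
  have hIt : ∫ z, Dt (fun z => f z - g z) z ^ 2 ≤ 4 :=
    (integral_sq_Dt_le hd hK hd0).trans hI
  have hIx : ∫ z, |Dx (fun z => f z - g z) z| ≤ V + 4 :=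
    (integral_abs_Dx_le hd hK hd0).trans (by gcongr)
  have hσK : ∀ z ∈ K, |∫ y in (0 : ℝ)..z.2, (f (z.1, y) - g (z.1, y))| ≤ σ := by
    intro z hz
    obtain ⟨w, hw, hzw⟩ := mem_iUnion₂.1 (hZ hz)
    have h1 := incr _ hd hd0 z hz w (hZK hw) a ha
    have h2 : |∫ y in (0 : ℝ)..w.2, (f (w.1, y) - g (w.1, y))| ≤ σ / 2 := by
      have h3 := (dist_le_pi_dist _ _ (⟨w, hw⟩ : Z)).trans hfg.le
      rw [Real.dist_eq] at h3
      have cf := hf.1.continuous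
      have cg := hg'.1.continuous
      rwa [intervalIntegral.integral_sub (Continuous.intervalIntegrable (by fun_prop) _ _)
        (Continuous.intervalIntegrable (by fun_prop) _ _)]
    have h4 : |z.1 - w.1| ≤ r := (le_max_left _ _).trans (Metric.mem_ball.1 hzw).le
    have h5 : |z.2 - w.2| ≤ r := (le_max_right _ _).trans (Metric.mem_ball.1 hzw).le
    have h6 : a / 2 * (R * (|z.1 - w.1| + |z.2 - w.2|)) ≤ σ / 4 := by
      calc _ ≤ a / 2 * (R * (r + r)) := by gcongr
        _ = _ := by simp only [r]; field_simp; norm_num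
    have h7 : 1 / a * ∫ z, Dt (fun z => f z - g z) z ^ 2 ≤ σ / 4 := by
      calc _ ≤ 1 / a * 4 := by gcongr
        _ = _ := by simp only [a]; field_simp; norm_num
    have h8 := abs_sub_abs_le_abs_sub (∫ y in (0 : ℝ)..z.2, (f (z.1, y) - g (z.1, y)))
      (∫ y in (0 : ℝ)..w.2, (f (w.1, y) - g (w.1, y)))
    linarith
  calc _ ≤ σ * ∫ z, |Dx (fun z => f z - g z) z| :=
        integral_sq_le_of_abs_primitive_le hd hK hd0 hσK
    _ ≤ σ * (V + 4) := by gcongr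
    _ = ρ := by simp only [σ]; field_simp

end Rellich

/-- Diagonal extraction: a sequence of functionals that is pointwise bounded on `S` and
asymptotically equicontinuous with respect to finite nets has a subsequence converging uniformly
on `S`. -/
theorem exists_subseq_uniform_limit {X : Type*} {S : Set X} {F : ℕ → X → ℝ}
    (hb : ∀ f ∈ S, ∃ B, ∀ n, |F n f| ≤ B)
    (hnet : ∀ δ > 0, ∃ N ⊆ S, N.Finite ∧ ∃ n₀, ∀ f ∈ S, ∃ g ∈ N, ∀ n ≥ n₀, |F n f - F n g| ≤ δ) :
    ∃ ks : ℕ → ℕ, StrictMono ks ∧ ∃ L : X → ℝ, ∀ δ > (0 : ℝ), ∃ N, ∀ n ≥ N, ∀ f ∈ S,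
      |F (ks n) f - L f| ≤ δ := by
  choose N hNS hNf n₀ hN using fun m : ℕ => hnet (1 / (m + 1 : ℝ)) Nat.one_div_pos_of_nat
  set D : Set X := ⋃ m, N m
  have hDc : D.Countable := countable_iUnion fun m => (hNf m).countable
  have hDS : ∀ g : D, (g : X) ∈ S := fun g => by
    obtain ⟨m, hm⟩ := mem_iUnion.1 g.2
    exact hNS m hm
  have := hDc.to_subtype
  choose B hB using fun g : D => hb g (hDS g)
  have hcomp : IsCompact (univ.pi fun g : D => Icc (-B g) (B g)) :=
    isCompact_univ_pi fun g => isCompact_Icc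
  obtain ⟨l, -, ks, hks, hl⟩ := hcomp.tendsto_subseq (x := fun n (g : D) => F n (g : X))
    (fun n g _ => abs_le.1 (hB g n))
  rw [tendsto_pi_nhds] at hl
  have cauchy : ∀ δ > (0 : ℝ), ∃ n₁, ∀ n ≥ n₁, ∀ m ≥ n₁, ∀ f ∈ S,
      |F (ks n) f - F (ks m) f| ≤ δ := by
    intro δ hδ
    obtain ⟨m, hm⟩ := exists_nat_one_div_lt (show 0 < δ / 4 by positivity)
    have hev : ∀ᶠ n in atTop, ∀ g ∈ N m, ∀ hg : g ∈ D, |F (ks n) g - l ⟨g, hg⟩| < δ / 4 := by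
      rw [eventually_all_finite (hNf m)]
      intro g hg
      have hgD : g ∈ D := mem_iUnion.2 ⟨m, hg⟩
      filter_upwards [Metric.tendsto_nhds.1 (hl ⟨g, hgD⟩) (δ / 4) (by positivity)] with n hn _
      exact hn
    obtain ⟨n₁, hn₁⟩ := eventually_atTop.1 (hev.and (eventually_ge_atTop (n₀ m)))
    refine ⟨n₁, fun n hn p hp f hf => ?_⟩
    obtain ⟨g, hg, hfg⟩ := hN m f hf
    have hgD : g ∈ D := mem_iUnion.2 ⟨m, hg⟩
    have a1 := hfg (ks n) ((hn₁ n hn).2.trans (hks.id_le n))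
    have a2 := hfg (ks p) ((hn₁ p hp).2.trans (hks.id_le p))
    have a3 := ((hn₁ n hn).1 g hg hgD).le
    have a4 := ((hn₁ p hp).1 g hg hgD).le
    rw [abs_le] at *
    constructor <;> linarith [a1.1, a1.2, a2.1, a2.2, a3.1, a3.2, a4.1, a4.2]
  have lim : ∀ f ∈ S, ∃ L, Tendsto (fun n => F (ks n) f) atTop (nhds L) := by
    intro f hf
    refine cauchySeq_tendsto_of_complete (Metric.cauchySeq_iff.2 fun δ hδ => ?_)
    obtain ⟨n₁, h⟩ := cauchy (δ / 2) (half_pos hδ)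
    refine ⟨n₁, fun n hn m hm => (h n hn m hm f hf).trans_lt (half_lt_self hδ)⟩
  classical
  refine ⟨ks, hks, fun f => if hf : f ∈ S then (lim f hf).choose else 0, fun δ hδ => ?_⟩
  obtain ⟨n₁, h⟩ := cauchy δ hδ
  refine ⟨n₁, fun n hn f hf => ?_⟩
  simp only [dif_pos hf]
  refine le_of_tendsto ((tendsto_const_nhds.sub (lim f hf).choose_spec).abs) ?_
  filter_upwards [eventually_ge_atTop n₁] with m hm using h n hn m hm f hf

theorem exists_smooth_cutoff {K Ω : Set (ℝ × ℝ)} (hK : IsCompact K) (hΩ : IsOpen Ω)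
    (hKΩ : K ⊆ Ω) :
    ∃ (K' : Set (ℝ × ℝ)) (χ : ℝ × ℝ → ℝ), IsCompact K' ∧ K ⊆ K' ∧ K' ⊆ Ω ∧ ContDiff ℝ 2 χ ∧
      (∀ z ∉ K', χ z = 0) ∧ (∀ z, 0 ≤ χ z) ∧ ∀ z ∈ K, χ z = 1 := by
  obtain ⟨K', hK', hKK', hK'Ω⟩ := exists_compact_between hK hΩ hKΩ
  obtain ⟨χ, h1, h0, h01⟩ := exists_contMDiffMap_one_nhds_of_subset_interior (n := 2)
    (modelWithCornersSelf ℝ (ℝ × ℝ)) hK.isClosed hKK'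
  exact ⟨K', χ, hK', hKK'.trans interior_subset, hK'Ω, χ.contMDiff.contDiff, h0,
    fun z => (h01 z).1, fun z hz => h1.self_of_nhdsSet z hz⟩

/-- Sequential compactness of the entropy productions, uniformly on the test ball. -/
theorem exists_subseq_entropy_production {T M C : ℝ} {K : Set (ℝ × ℝ)} {η q : ℝ → ℝ}
    (hη : ContDiff ℝ 2 η) (hq : ∀ w, HasDerivAt q (3 * w ^ 2 * deriv η w) w)
    (hM : 0 ≤ M) (hC : 0 ≤ C) (hK : IsCompact K) (hKT : K ⊆ Ioo (0 : ℝ) T ×ˢ Ioi (0 : ℝ))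
    {U : ℕ → ℝ × ℝ → ℝ} {ε : ℕ → ℝ} (hU : ∀ n, ContDiff ℝ 2 (U n)) (hε : ∀ n, 0 < ε n)
    (hε0 : Tendsto ε atTop (nhds 0))
    (hUM : ∀ n, ∀ z ∈ Ioo (0 : ℝ) T ×ˢ Ioi (0 : ℝ), |U n z| ≤ M)
    (hUC : ∀ n, ∀ z ∈ Ioo (0 : ℝ) T ×ˢ Ioi (0 : ℝ), |source (ε n) (U n) z| ≤ C) :
    ∃ ks : ℕ → ℕ, StrictMono ks ∧ ∃ L : (ℝ × ℝ → ℝ) → ℝ, ∀ δ > (0 : ℝ), ∃ N, ∀ n ≥ N,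
      ∀ f ∈ testBall K,
        |(∫ z, (η (U (ks n) z) * Dt f z + q (U (ks n) z) * Dx f z)) - L f| ≤ δ := by
  obtain ⟨K', χ, hK', hKK', hK'Ω, hχ, h0, hpos, h1⟩ :=
    exists_smooth_cutoff hK (isOpen_Ioo.prod isOpen_Ioi) hKT
  obtain ⟨E, hE⟩ := hε0.bddAbove_range
  have hεE : ∀ n, ε n ≤ E := fun n => hE (mem_range_self n)
  obtain ⟨A, hA, hbound⟩ := exists_entropy_production_bound hη hq hχ hK hK' hKK' h0 hpos h1 hM hC
    ((hε 0).le.trans (hεE 0))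
  have hqc : Continuous q := continuous_iff_continuousAt.2 fun w => (hq w).continuousAt
  have hint : ∀ n, ∀ f ∈ testBall K,
      Integrable fun z => η (U n z) * Dt f z + q (U n z) * Dx f z := by
    intro n f hf
    have c1 := continuous_dirDeriv hf.1 (1, 0)
    have c2 := continuous_dirDeriv hf.1 (0, 1)
    have z1 := dirDeriv_eq_zero hK.isClosed hf.2.1 (1, 0)
    have z2 := dirDeriv_eq_zero hK.isClosed hf.2.1 (0, 1)
    have c3 := hη.continuous.comp (hU n).continuous
    have c4 := hqc.comp (hU n).continuous
    exact integrable_of_eq_zero_off_compact ((c3.mul c1).add (c4.mul c2)) hK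
      (by intro z hz; simp [z1 z hz, z2 z hz])
  have hsub : ∀ f ∈ testBall K, ∀ g ∈ testBall K, ∀ k, 0 < k → ∫ z, (f z - g z) ^ 2 ≤ k ^ 4 →
      ∀ n, |(∫ z, (η (U n z) * Dt f z + q (U n z) * Dx f z))
        - ∫ z, (η (U n z) * Dt g z + q (U n z) * Dx g z)| ≤ A * (√(ε n) + k) := by
    intro f hf g hg k hk hfg n
    have hd : ∀ z ∉ K, f z - g z = 0 := fun z hz => by rw [hf.2.1 z hz, hg.2.1 z hz, sub_zero]
    have := hbound (U n) (ε n) (hU n) (hε n) (hεE n) (fun z hz => hUM n z (hK'Ω hz))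
      (fun z hz => hUC n z (hK'Ω hz)) (fun z => f z - g z) k (hf.1.sub hg.1) hd hk
      (integral_sq_Dt_Dx_sub_le hK hf hg) hfg
    rw [← integral_sub (hint n f hf) (hint n g hg)]
    refine le_trans (le_of_eq ?_) this
    congr 2
    funext z
    have e : ∀ v, dirDeriv v (fun z => f z - g z) z = dirDeriv v f z - dirDeriv v g z :=
      fun v => dirDeriv_sub (hf.1.differentiable (by norm_num) z)
        (hg.1.differentiable (by norm_num) z) v
    rw [e, e]; ring
  refine exists_subseq_uniform_limit
    (F := fun n f => ∫ z, (η (U n z) * Dt f z + q (U n z) * Dx f z)) (fun f hf => ?_)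
    (fun δ hδ => ?_)
  · have zero_mem : (fun _ => 0 : ℝ × ℝ → ℝ) ∈ testBall K :=
      ⟨contDiff_const, fun _ _ => rfl, by simp [dirDeriv]⟩
    have h2 : 0 ≤ ∫ z, f z ^ 2 := integral_nonneg fun z => sq_nonneg _
    set J := ∫ z, f z ^ 2
    refine ⟨A * (√E + (1 + J)), fun n => ?_⟩
    have := hsub f hf _ zero_mem (1 + J) (by positivity)
      (by simp only [sub_zero]; nlinarith [sq_nonneg J, pow_nonneg h2 3, pow_nonneg h2 4]) n
    simp only [dirDeriv, fderiv_const_apply, zero_apply, mul_zero, add_zero,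
      integral_zero, sub_zero] at this
    refine this.trans ?_
    gcongr
    exact hεE n
  · have hk : 0 < δ / (2 * A) := by positivity
    obtain ⟨N, hNS, hNf, hN⟩ := exists_finite_net_testBall hK hKT (pow_pos hk 4)
    have hs : Tendsto (fun n => √(ε n)) atTop (nhds 0) := by
      simpa using hε0.sqrt
    obtain ⟨n₀, hn₀⟩ := eventually_atTop.1 (hs.eventually_lt_const hk)
    refine ⟨N, hNS, hNf, n₀, fun f hf => ?_⟩
    obtain ⟨g, hg, hfg⟩ := hN f hf
    refine ⟨g, hg, fun n hn => (hsub f hf g (hNS hg) _ hk hfg n).trans ?_⟩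
    calc _ ≤ A * (δ / (2 * A) + δ / (2 * A)) := by gcongr; exact (hn₀ n hn).le
      _ = δ := by field_simp; norm_num

/-- **Lemma 3.2, step 4 (Murat's lemma).** Under the uniform `L^∞` bounds on `u_ε`, `P_ε`
and the dissipation bound, for every convex entropy `η ∈ C²(ℝ)` with flux
`q(w) = ∫_0^w 3ξ²η′(ξ) dξ` the family of distributions
`{∂ₜη(u_ε) + ∂ₓq(u_ε)}_{ε>0}` lies in a compact subset of `H^{-1}_loc((0,T)×(0,∞))`:
every sequence `ε_k → 0⁺` admits a subsequence along which the pairings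
`φ ↦ −∫∫ (η(u_ε)∂ₜφ + q(u_ε)∂ₓφ)` converge uniformly on the `H¹₀`-unit ball of test
functions supported in any fixed compact subset of `(0,T)×(0,∞)`. -/
theorem viscous_entropy_production_Hminus1loc_compact
    (T : ℝ) (hT : 0 < T)
    -- `M₀ = ‖u₀‖_{L^∞(0,∞)}`
    (u₀ : ℝ → ℝ) (M₀ : ℝ)
    (hM₀ : M₀ = (eLpNorm u₀ ⊤ (volume.restrict (Ioi (0:ℝ)))).toReal)
    -- the family of viscous solutions and approximate data
    (u P : ℝ → ℝ → ℝ → ℝ) (gε u₀ε : ℝ → ℝ → ℝ)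
    (hu_smooth : ∀ ε > (0:ℝ), ContDiff ℝ (⊤ : ℕ∞) (Function.uncurry (u ε)))
    (hPdef : ∀ ε > (0:ℝ), ∀ t x : ℝ, P ε t x = ∫ y in (0:ℝ)..x, u ε t y)
    (hPDE : ∀ ε > (0:ℝ), ∀ t > (0:ℝ), ∀ x > (0:ℝ),
        deriv (fun s => u ε s x) t + 3 * (u ε t x) ^ 2 * deriv (u ε t) x
          = P ε t x + ε * deriv (deriv (u ε t)) x)
    (hbc : ∀ ε > (0:ℝ), ∀ t > (0:ℝ), u ε t 0 = gε ε t)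
    (hic : ∀ ε > (0:ℝ), ∀ x > (0:ℝ), u ε 0 x = u₀ε ε x)
    -- a convex entropy `η ∈ C²(ℝ)`
    (η : ℝ → ℝ) (hη : ContDiff ℝ 2 η) (hconv : ConvexOn ℝ univ η)
    -- the uniform bounds, with `C = C(T)` independent of `ε`
    (C : ℝ) (hC : 0 < C)
    (hu_bound : ∀ ε > (0:ℝ), ∀ t ∈ Ioo (0:ℝ) T, ∀ x > (0:ℝ), |u ε t x| ≤ M₀ + C)
    (hdiss : ∀ ε > (0:ℝ),
        ε * ∫ s in (0:ℝ)..T, ∫ x in Ioi (0:ℝ), (deriv (u ε s) x) ^ 2 ≤ C)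
    -- the uniform bound `‖P_ε‖_{L^∞((0,T)×(0,∞))} ≤ C(T)`
    (hP_bound : ∀ ε > (0:ℝ), ∀ t ∈ Ioo (0:ℝ) T, ∀ x > (0:ℝ), |P ε t x| ≤ C)
    -- the entropy flux `q(w) = ∫_0^w 3ξ²η′(ξ) dξ`
    (q : ℝ → ℝ) (hq : ∀ w : ℝ, q w = ∫ ξ in (0:ℝ)..w, 3 * ξ ^ 2 * deriv η ξ) :
    ∀ εk : ℕ → ℝ, (∀ n, 0 < εk n) → Tendsto εk atTop (nhds 0) →
    ∀ K : Set (ℝ × ℝ), IsCompact K → K ⊆ (Ioo (0:ℝ) T) ×ˢ (Ioi (0:ℝ)) →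
      ∃ ks : ℕ → ℕ, StrictMono ks ∧
      ∃ L : (ℝ → ℝ → ℝ) → ℝ,
        ∀ δ > (0:ℝ), ∃ N : ℕ, ∀ n ≥ N,
          ∀ φ : ℝ → ℝ → ℝ, ContDiff ℝ 1 (Function.uncurry φ) →
            HasCompactSupport (Function.uncurry φ) →
            (Function.support (Function.uncurry φ) ⊆ K) →
            (∫ t in Ioo (0:ℝ) T, ∫ x in Ioi (0:ℝ),
                ((φ t x) ^ 2 + (deriv (fun s => φ s x) t) ^ 2
                  + (deriv (fun y => φ t y) x) ^ 2) ≤ 1) →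
            |(-(∫ t in Ioo (0:ℝ) T, ∫ x in Ioi (0:ℝ),
                  (η (u (εk (ks n)) t x) * deriv (fun s => φ s x) t
                    + q (u (εk (ks n)) t x) * deriv (fun y => φ t y) x)))
              - L φ| ≤ δ := by
  intro εk hεk hεk0 K hK hKT
  have hη' : Continuous (deriv η) := hη.continuous_deriv (by norm_num)
  have hqd : ∀ w, HasDerivAt q (3 * w ^ 2 * deriv η w) w := by
    intro w
    rw [show q = fun w => ∫ ξ in (0:ℝ)..w, 3 * ξ ^ 2 * deriv η ξ from funext hq]
    exact (Continuous.integral_hasStrictDerivAt (f := fun ξ => 3 * ξ ^ 2 * deriv η ξ)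
      (by fun_prop) 0 w).hasDerivAt
  have hM : 0 ≤ M₀ + C := (abs_nonneg _).trans
    (hu_bound 1 one_pos (T / 2) ⟨half_pos hT, half_lt_self hT⟩ 1 one_pos)
  have hU : ∀ ε > (0:ℝ), ContDiff ℝ 2 (Function.uncurry (u ε)) := fun ε hε =>
    (hu_smooth ε hε).of_le (WithTop.coe_le_coe.2 (le_top : (2 : ℕ∞) ≤ ⊤))
  have hsource : ∀ ε > (0:ℝ), ∀ z ∈ Ioo (0:ℝ) T ×ˢ Ioi (0:ℝ),
      |source ε (Function.uncurry (u ε)) z| ≤ C := by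
    rintro ε hε ⟨t, x⟩ ⟨ht, hx⟩
    have hd : Differentiable ℝ (Function.uncurry (u ε)) := (hU ε hε).differentiable (by norm_num)
    have hUx : ContDiff ℝ 1 (Dx (Function.uncurry (u ε))) :=
      contDiff_dirDeriv (hU ε hε) (by norm_num) _
    have e1 := deriv_fst_eq_Dt (hd (t, x))
    have e2 : deriv (u ε t) = fun y => Dx (Function.uncurry (u ε)) (t, y) :=
      funext fun y => deriv_snd_eq_Dx (hd (t, y))
    have e3 : deriv (fun y => Dx (Function.uncurry (u ε)) (t, y)) x
        = Dx (Dx (Function.uncurry (u ε))) (t, x) :=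
      deriv_snd_eq_Dx (φ := fun t y => Dx (Function.uncurry (u ε)) (t, y))
        (hUx.differentiable (by norm_num) (t, x))
    have h := hPDE ε hε t ht.1 x hx
    rw [e1, e2, e3] at h
    have hs : source ε (Function.uncurry (u ε)) (t, x) = P ε t x := by
      simp only [source, Function.uncurry_apply_pair] at h ⊢
      linarith
    rw [hs]
    exact hP_bound ε hε t ht x hx
  obtain ⟨ks, hks, L, hL⟩ := exists_subseq_entropy_production
    (U := fun n => Function.uncurry (u (εk n))) hη hqd hM hC.le hK hKT (fun n => hU _ (hεk n)) hεk
    hεk0 (fun n z hz => hu_bound _ (hεk n) z.1 hz.1 z.2 hz.2) (fun n => hsource _ (hεk n))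
  refine ⟨ks, hks, fun φ => -L (Function.uncurry φ), fun δ hδ => ?_⟩
  obtain ⟨N, hN⟩ := hL δ hδ
  refine ⟨N, fun n hn φ hφ _ hφK hφ1 => ?_⟩
  have h0 : ∀ z ∉ K, Function.uncurry φ z = 0 := fun z hz => by
    by_contra hne
    exact hz (hφK hne)
  have hd : Differentiable ℝ (Function.uncurry φ) := hφ.differentiable (by norm_num)
  have e1 : ∀ t x, deriv (fun s => φ s x) t = Dt (Function.uncurry φ) (t, x) :=
    fun t x => deriv_fst_eq_Dt (hd (t, x))
  have e2 : ∀ t x, deriv (fun y => φ t y) x = Dx (Function.uncurry φ) (t, x) :=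
    fun t x => deriv_snd_eq_Dx (hd (t, x))
  simp only [e1, e2] at hφ1 ⊢
  have c0 := hφ.continuous
  have c1 := continuous_dirDeriv hφ (1, 0)
  have c2 := continuous_dirDeriv hφ (0, 1)
  have z1 := dirDeriv_eq_zero hK.isClosed h0 (1, 0)
  have z2 := dirDeriv_eq_zero hK.isClosed h0 (0, 1)
  have hmem : Function.uncurry φ ∈ testBall K := by
    refine ⟨hφ, h0, ?_⟩
    rw [← setIntegral_Ioo_Ioi_eq (by fun_prop) hK hKT
      (by intro z hz; simp [z1 z hz, z2 z hz, h0 z hz])]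
    exact hφ1
  have hqc : Continuous q := continuous_iff_continuousAt.2 fun w => (hqd w).continuousAt
  have hUc := (hU _ (hεk (ks n))).continuous
  have c3 := hη.continuous.comp hUc
  have c4 := hqc.comp hUc
  have h := hN n hn _ hmem
  have h3 := setIntegral_Ioo_Ioi_eq
    (f := fun z => η (Function.uncurry (u (εk (ks n))) z) * Dt (Function.uncurry φ) z
      + q (Function.uncurry (u (εk (ks n))) z) * Dx (Function.uncurry φ) z)
    ((c3.mul c1).add (c4.mul c2)) hK hKT (by intro z hz; simp [z1 z hz, z2 z hz])
  rw [← h3] at h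
  rw [← abs_neg, neg_sub, sub_neg_eq_add, neg_add_eq_sub]
  exact h
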